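/- arXiv:1902.03513 — 3 statements merged into one kernel-verified Lean document; each statement's English description precedes it below -/
import Mathlib

section
/- Let K be a closed convex cone in 𝓛 with 𝓛≥ ⊆ K. Then K ∩ 𝓛< ≠ ∅ (K is not coherent) if and only if there is no state L on 𝓛 with L(g) ≥ 0 for all g ∈ K; moreover, in that case every continuous linear functional that is nonnegative on K is identically zero, i.e. K• = {0}. -/
open BoundedContinuousFunction

noncomputable section

/-- The set of nonnegative gambles `𝓛≥`. -/
def Lnn (Ω : Type*) [TopologicalSpace Ω] : Set (Ω →ᵇ ℝ) := {g | ∀ ω, 0 ≤ g ω}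

/-- The set of negative gambles `𝓛<` (supremum strictly negative). -/
def Lneg (Ω : Type*) [TopologicalSpace Ω] : Set (Ω →ᵇ ℝ) := {g | (⨆ ω, g ω) < 0}

/-- A state: a continuous linear functional nonnegative on `𝓛≥` with `L(𝟙) = 1`. -/
def IsState {Ω : Type*} [TopologicalSpace Ω] (L : (Ω →ᵇ ℝ) →L[ℝ] ℝ) : Prop :=
  (∀ g : Ω →ᵇ ℝ, (∀ ω, 0 ≤ g ω) → 0 ≤ L g) ∧
    L (BoundedContinuousFunction.const Ω (1 : ℝ)) = 1

/-- The dual `K•` of a set of gambles. -/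
def dualSet {Ω : Type*} [TopologicalSpace Ω] (K : Set (Ω →ᵇ ℝ)) :
    Set ((Ω →ᵇ ℝ) →L[ℝ] ℝ) :=
  {L | ∀ g ∈ K, 0 ≤ L g}

section

variable {Ω : Type*} [TopologicalSpace Ω]

/-- A functional nonnegative on `𝓛≥` that vanishes at `𝟙` is zero. -/
theorem eq_zero_of_nonneg_of_apply_one_eq_zero {L : (Ω →ᵇ ℝ) →L[ℝ] ℝ}
    (hL : L ∈ dualSet (Lnn Ω)) (h1 : L (const Ω (1 : ℝ)) = 0) : L = 0 := by
  have hle (g : Ω →ᵇ ℝ) : L g ≤ 0 := by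
    have h := hL (‖g‖ • const Ω (1 : ℝ) - g) fun ω => by
      simpa using (le_abs_self _).trans (g.norm_coe_le_norm ω)
    rw [map_sub, map_smul, h1, smul_zero] at h
    linarith
  ext g
  have h := hle (-g)
  rw [map_neg] at h
  exact le_antisymm (hle g) (by simpa using h)

/-- A functional nonnegative on `𝓛≥` and at some negative gamble is zero. -/
theorem eq_zero_of_nonneg_of_mem_Lneg {L : (Ω →ᵇ ℝ) →L[ℝ] ℝ} (hL : L ∈ dualSet (Lnn Ω))
    {f : Ω →ᵇ ℝ} (hf : f ∈ Lneg Ω) (hLf : 0 ≤ L f) : L = 0 := by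
  have hsup : (⨆ ω, f ω) < 0 := hf
  refine eq_zero_of_nonneg_of_apply_one_eq_zero hL (le_antisymm ?_ (hL _ fun ω => by simp))
  have h := hL ((⨆ ω, f ω) • const Ω (1 : ℝ) - f) fun ω => by
    simpa using le_ciSup f.isBounded_range.bddAbove ω
  rw [map_sub, map_smul, smul_eq_mul] at h
  by_contra! hpos
  linarith [mul_neg_of_neg_of_pos hsup hpos]

/-- A closed convex cone containing `𝓛≥` but not `-𝟙` has a state that is nonnegative on it. -/
theorem exists_isState_of_neg_one_notMem {K : Set (Ω →ᵇ ℝ)} (hK : IsClosed K)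
    (hconv : Convex ℝ K) (hcone : ∀ c : ℝ, 0 < c → ∀ g ∈ K, c • g ∈ K) (hLnn : Lnn Ω ⊆ K)
    (hone : -const Ω (1 : ℝ) ∉ K) : ∃ L : (Ω →ᵇ ℝ) →L[ℝ] ℝ, IsState L ∧ L ∈ dualSet K := by
  obtain ⟨f, u, hfu, huK⟩ := geometric_hahn_banach_point_closed hconv hK hone
  have hu : u < 0 := by simpa using huK 0 (hLnn fun ω => by simp)
  have hf1 : 0 < f (const Ω (1 : ℝ)) := by
    rw [map_neg] at hfu
    linarith
  have hfK : ∀ g ∈ K, 0 ≤ f g := by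
    intro g hg
    by_contra! hneg
    have h := huK _ (hcone _ (div_pos_of_neg_of_neg hu hneg) g hg)
    rw [map_smul, smul_eq_mul, div_mul_cancel₀ _ hneg.ne] at h
    exact h.false
  have hLK : ∀ g ∈ K, 0 ≤ ((f (const Ω (1 : ℝ)))⁻¹ • f) g := fun g hg =>
    mul_nonneg (inv_nonneg.2 hf1.le) (hfK g hg)
  exact ⟨_, ⟨fun g hg => hLK g (hLnn hg), inv_mul_cancel₀ hf1.ne'⟩, hLK⟩

end

/-- for a closed convex cone `K ⊇ 𝓛≥`, incoherence (`K ∩ 𝓛< ≠ ∅`) is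
equivalent to the non-existence of a state nonnegative on `K`; moreover in that
case `K• = {0}`. -/
theorem stmt3 {Ω : Type*} [Nonempty Ω] [TopologicalSpace Ω] [DiscreteTopology Ω]
    (K : Set (Ω →ᵇ ℝ)) (hK : IsClosed K) (hconv : Convex ℝ K)
    (hcone : ∀ c : ℝ, 0 < c → ∀ g ∈ K, c • g ∈ K) (hLnn : Lnn Ω ⊆ K) :
    ((K ∩ Lneg Ω).Nonempty ↔
        ¬∃ L : (Ω →ᵇ ℝ) →L[ℝ] ℝ, IsState L ∧ ∀ g ∈ K, 0 ≤ L g)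
    ∧ ((K ∩ Lneg Ω).Nonempty → dualSet K = {0}) := by
  have hzero : (K ∩ Lneg Ω).Nonempty → ∀ L ∈ dualSet K, L = 0 := by
    rintro ⟨f, hfK, hf⟩ L hL
    exact eq_zero_of_nonneg_of_mem_Lneg (fun g hg => hL g (hLnn hg)) hf (hL f hfK)
  refine ⟨⟨?_, ?_⟩, fun h => Set.eq_singleton_iff_unique_mem.2 ⟨fun g _ => by simp, hzero h⟩⟩
  · rintro h ⟨L, hL, hLK⟩
    have h1 := hL.2
    rw [hzero h L hLK] at h1
    exact zero_ne_one h1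
  · intro h
    by_contra hne
    refine h (exists_isState_of_neg_one_notMem hK hconv hcone hLnn fun hmem => ?_)
    exact hne ⟨_, hmem, by simp [Lneg]⟩
end
end

section
/- Let Σ≥ ⊆ 𝓛≥ ∩ 𝓛_R be a convex cone, closed in 𝓛_R, containing all nonnegative constant gambles, and let C ⊆ 𝓛_R be a P-coherent set of desirable gambles. The following are equivalent: (1) C contains a gamble g with sup g < 0 (any such g necessarily does not belong to Σ<); (2) posi(𝓛≥ ∪ C) ∩ 𝓛< ≠ ∅, i.e. the deductive closure of C in the full theory is incoherent, so its associated set 𝒫 of compatible states is empty; (3) there is no state L on 𝓛 with L(g) ≥ 0 for every g ∈ C, i.e. every continuous linear functional on 𝓛 that is nonnegative on C and normalized (L(𝟙)=1) fails to be nonnegative on 𝓛≥ (it corresponds only to signed charges). -/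
open BoundedContinuousFunction

noncomputable section

/-- `posi 𝒢`: all finite nonnegative linear combinations of elements of `𝒢`. -/
def posi {Ω : Type*} [TopologicalSpace Ω] (𝒢 : Set (Ω →ᵇ ℝ)) : Set (Ω →ᵇ ℝ) :=
  {h | ∃ (ℓ : ℕ) (lam : Fin ℓ → ℝ) (gs : Fin ℓ → Ω →ᵇ ℝ),
    (∀ i, 0 ≤ lam i) ∧ (∀ i, gs i ∈ 𝒢) ∧ h = ∑ i, lam i • gs i}

/-- The set `Σ<` of P-negative gambles relative to `Σ≥` and `𝓛_R`. -/
def Sneg {Ω : Type*} [TopologicalSpace Ω] (LR : Submodule ℝ (Ω →ᵇ ℝ))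
    (Sig : Set (Ω →ᵇ ℝ)) : Set (Ω →ᵇ ℝ) :=
  {f | f ∈ LR ∧ ∃ δ : ℝ, 0 < δ ∧
    -f - δ • BoundedContinuousFunction.const Ω (1 : ℝ) ∈ Sig}

/-- A P-coherent set of desirable gambles: the closure of `posi (Σ≥ ∪ 𝒢)` for
some `𝒢 ⊆ 𝓛_R`, disjoint from `Σ<`. -/
def PCoherent {Ω : Type*} [TopologicalSpace Ω] (LR : Submodule ℝ (Ω →ᵇ ℝ))
    (Sig : Set (Ω →ᵇ ℝ)) (C : Set (Ω →ᵇ ℝ)) : Prop :=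
  (∃ 𝒢 ⊆ (LR : Set (Ω →ᵇ ℝ)), C = closure (posi (Sig ∪ 𝒢))) ∧
    C ∩ Sneg LR Sig = ∅

open scoped NNReal

theorem posi_eq_span {Ω : Type*} [TopologicalSpace Ω] (S : Set (Ω →ᵇ ℝ)) :
    posi S = (Submodule.span ℝ≥0 S : Set (Ω →ᵇ ℝ)) := by
  ext h
  rw [SetLike.mem_coe, Submodule.mem_span_set']
  constructor
  · rintro ⟨l, lam, gs, hlam, hgs, rfl⟩
    exact ⟨l, fun i => ⟨lam i, hlam i⟩, fun i => ⟨gs i, hgs i⟩, rfl⟩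
  · rintro ⟨l, lam, gs, rfl⟩
    exact ⟨l, fun i => lam i, fun i => gs i, fun i => (lam i).2, fun i => (gs i).2, rfl⟩

theorem apply_le_iSup {Ω : Type*} [TopologicalSpace Ω] (g : Ω →ᵇ ℝ) (ω : Ω) :
    g ω ≤ ⨆ ω, g ω :=
  le_ciSup g.isBounded_range.bddAbove ω

theorem mem_Lneg_iff {Ω : Type*} [Nonempty Ω] [TopologicalSpace Ω] {g : Ω →ᵇ ℝ} :
    g ∈ Lneg Ω ↔ ∃ ε > 0, ∀ ω, g ω ≤ -ε := by
  constructor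
  · intro hg
    exact ⟨-⨆ ω, g ω, neg_pos.2 hg, fun ω => by simpa using apply_le_iSup g ω⟩
  · rintro ⟨ε, hε, hg⟩
    exact (ciSup_le hg).trans_lt (neg_neg_of_pos hε)

theorem mem_Lneg_of_le {Ω : Type*} [Nonempty Ω] [TopologicalSpace Ω] {g h : Ω →ᵇ ℝ}
    (hh : h ∈ Lneg Ω) (hgh : ∀ ω, g ω ≤ h ω) : g ∈ Lneg Ω := by
  obtain ⟨ε, hε, hle⟩ := mem_Lneg_iff.1 hh
  exact mem_Lneg_iff.2 ⟨ε, hε, fun ω => (hgh ω).trans (hle ω)⟩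

theorem isOpen_Lneg {Ω : Type*} [Nonempty Ω] [TopologicalSpace Ω] : IsOpen (Lneg Ω) := by
  refine Metric.isOpen_iff.2 fun g hg => ?_
  obtain ⟨ε, hε, hle⟩ := mem_Lneg_iff.1 hg
  refine ⟨ε / 2, half_pos hε, fun f hf => mem_Lneg_iff.2 ⟨ε / 2, half_pos hε, fun ω => ?_⟩⟩
  have h := (dist_coe_le_dist (f := f) (g := g) ω).trans_lt (Metric.mem_ball.1 hf)
  rw [Real.dist_eq] at h
  linarith [le_abs_self (f ω - g ω), hle ω]

theorem convex_Lneg {Ω : Type*} [Nonempty Ω] [TopologicalSpace Ω] : Convex ℝ (Lneg Ω) := by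
  refine convex_iff_forall_pos.2 fun f hf g hg a b ha hb _ => ?_
  obtain ⟨ε, hε, hf⟩ := mem_Lneg_iff.1 hf
  obtain ⟨δ, hδ, hg⟩ := mem_Lneg_iff.1 hg
  refine mem_Lneg_iff.2 ⟨a * ε + b * δ, by positivity, fun ω => ?_⟩
  simp only [coe_add, coe_smul, Pi.add_apply, smul_eq_mul]
  linarith [mul_le_mul_of_nonneg_left (hf ω) ha.le, mul_le_mul_of_nonneg_left (hg ω) hb.le]

/-- The set of nonnegative gambles as a cone. -/
def nonnegCone (Ω : Type*) [TopologicalSpace Ω] : Submodule ℝ≥0 (Ω →ᵇ ℝ) where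
  carrier := Lnn Ω
  add_mem' hf hg ω := add_nonneg (hf ω) (hg ω)
  zero_mem' _ := le_rfl
  smul_mem' c _ hf ω := mul_nonneg c.2 (hf ω)

theorem IsState.apply_neg_of_mem_Lneg {Ω : Type*} [Nonempty Ω] [TopologicalSpace Ω]
    {L : (Ω →ᵇ ℝ) →L[ℝ] ℝ} (hL : IsState L) {g : Ω →ᵇ ℝ} (hg : g ∈ Lneg Ω) : L g < 0 := by
  obtain ⟨ε, hε, hle⟩ := mem_Lneg_iff.1 hg
  have h := hL.1 (-g - ε • BoundedContinuousFunction.const Ω (1 : ℝ)) fun ω => by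
    simp only [coe_sub, coe_neg, coe_smul, Pi.sub_apply, Pi.neg_apply, const_apply, smul_eq_mul]
    linarith [hle ω]
  rw [map_sub, map_neg, map_smul, hL.2, smul_eq_mul] at h
  linarith

/-- A convex cone of gambles that avoids the negative gambles is compatible with some state. -/
theorem exists_isState_of_disjoint_Lneg {Ω : Type*} [Nonempty Ω] [TopologicalSpace Ω]
    (K : Submodule ℝ≥0 (Ω →ᵇ ℝ)) (hK : Disjoint (Lneg Ω) K) :
    ∃ L : (Ω →ᵇ ℝ) →L[ℝ] ℝ, IsState L ∧ ∀ g ∈ K, 0 ≤ L g := by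
  have hKconv : Convex ℝ (K : Set (Ω →ᵇ ℝ)) := fun f hf g hg a b ha hb _ =>
    K.add_mem (K.smul_mem ⟨a, ha⟩ hf) (K.smul_mem ⟨b, hb⟩ hg)
  obtain ⟨f, u, hneg, hpos⟩ := geometric_hahn_banach_open convex_Lneg isOpen_Lneg hKconv hK
  have hu : u ≤ 0 := by simpa using hpos 0 K.zero_mem
  have hfK : ∀ g ∈ K, 0 ≤ f g := by
    intro g hg
    by_contra! hlt
    have hc : 0 ≤ (u - 1) / f g := div_nonneg_of_nonpos (by linarith) hlt.le
    have h : u ≤ (u - 1) / f g * f g :=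
      (hpos _ (K.smul_mem ⟨(u - 1) / f g, hc⟩ hg)).trans_eq (map_smul f ((u - 1) / f g) g)
    rw [div_mul_cancel₀ _ hlt.ne] at h
    linarith
  set e := BoundedContinuousFunction.const Ω (1 : ℝ) with he
  have hshift : ∀ g ∈ Lnn Ω, ∀ ε > 0, 0 < f g + ε * f e := by
    intro g hg ε hε
    have h := hneg (-g - ε • e) (mem_Lneg_iff.2 ⟨ε, hε, fun ω => by
      simp only [he, coe_sub, coe_neg, coe_smul, Pi.sub_apply, Pi.neg_apply, const_apply,
        smul_eq_mul]
      linarith [hg ω]⟩)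
    rw [map_sub, map_neg, map_smul, smul_eq_mul] at h
    linarith
  have hfe : 0 < f e := by simpa using hshift 0 (fun _ => le_rfl) 1 one_pos
  have hfnn : ∀ g ∈ Lnn Ω, 0 ≤ f g := by
    intro g hg
    refine le_of_forall_pos_lt_add fun ε hε => ?_
    have h := hshift g hg (ε / f e) (div_pos hε hfe)
    rwa [div_mul_cancel₀ _ hfe.ne'] at h
  refine ⟨(f e)⁻¹ • f, ⟨fun g hg => ?_, inv_mul_cancel₀ hfe.ne'⟩, fun g hg => ?_⟩
  · exact mul_nonneg (inv_nonneg.2 hfe.le) (hfnn g hg)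
  · exact mul_nonneg (inv_nonneg.2 hfe.le) (hfK g hg)

/-- the fundamental theorem: for `Σ≥ ⊆ 𝓛≥ ∩ 𝓛_R` a closed convex
cone containing the nonnegative constants, and `C ⊆ 𝓛_R` P-coherent, the
following are equivalent: (1) `C` contains a negative gamble; (2) the deductive
closure `posi (𝓛≥ ∪ C)` is incoherent; (3) no state on `𝓛` is nonnegative on
`C`. -/
theorem stmt8 {Ω : Type*} [Nonempty Ω] [TopologicalSpace Ω] [DiscreteTopology Ω]
    (LR : Submodule ℝ (Ω →ᵇ ℝ)) (hLRclosed : IsClosed (LR : Set (Ω →ᵇ ℝ)))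
    (hLRconst : ∀ c : ℝ, BoundedContinuousFunction.const Ω c ∈ LR)
    (Sig : Set (Ω →ᵇ ℝ)) (hSigsub : Sig ⊆ Lnn Ω ∩ (LR : Set (Ω →ᵇ ℝ)))
    (hSigconv : Convex ℝ Sig) (hSigcone : ∀ c : ℝ, 0 < c → ∀ g ∈ Sig, c • g ∈ Sig)
    (hSigclosed : IsClosed Sig)
    (hSigconst : ∀ c : ℝ, 0 ≤ c → BoundedContinuousFunction.const Ω c ∈ Sig)
    (C : Set (Ω →ᵇ ℝ)) (hCsub : C ⊆ (LR : Set (Ω →ᵇ ℝ)))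
    (hC : PCoherent LR Sig C) :
    ((∃ g ∈ C, (⨆ ω, g ω) < 0) ↔ (posi (Lnn Ω ∪ C) ∩ Lneg Ω ≠ ∅))
    ∧ ((∃ g ∈ C, (⨆ ω, g ω) < 0) ↔
        ¬∃ L : (Ω →ᵇ ℝ) →L[ℝ] ℝ, IsState L ∧ ∀ g ∈ C, 0 ≤ L g) := by
  obtain ⟨⟨𝒢, -, hCeq⟩, -⟩ := hC
  set K := (Submodule.span ℝ≥0 (Sig ∪ 𝒢)).topologicalClosure
  obtain rfl : C = K := by rw [hCeq, posi_eq_span, ← Submodule.topologicalClosure_coe]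
  refine ⟨⟨?_, ?_⟩, ⟨?_, fun h => ?_⟩⟩
  · rintro ⟨g, hgK, hg⟩
    rw [← Set.nonempty_iff_ne_empty, posi_eq_span]
    exact ⟨g, Submodule.subset_span (Or.inr hgK), hg⟩
  · rw [← Set.nonempty_iff_ne_empty, posi_eq_span]
    rintro ⟨h, hmem, hh⟩
    have hspan : Submodule.span ℝ≥0 (Lnn Ω ∪ K) = nonnegCone Ω ⊔ K := by
      rw [Submodule.span_union, Submodule.span_eq K]
      exact congrArg (· ⊔ K) (Submodule.span_eq (nonnegCone Ω))
    rw [SetLike.mem_coe, hspan, Submodule.mem_sup] at hmem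
    obtain ⟨p, hp, g, hg, rfl⟩ := hmem
    exact ⟨g, hg, mem_Lneg_of_le hh fun ω => le_add_of_nonneg_left (hp ω)⟩
  · rintro ⟨g, hgK, hg⟩ ⟨L, hL, hLK⟩
    exact (hLK g hgK).not_gt (hL.apply_neg_of_mem_Lneg hg)
  · by_contra hK
    exact h (exists_isState_of_disjoint_Lneg K
      (Set.disjoint_left.2 fun g hg hgK => hK ⟨g, hgK, hg⟩))
end
end

section
/- Let ρ_e := (1/2)·[[1,0,0,1],[0,0,0,0],[0,0,0,0],[1,0,0,1]] and H := [[0,0,0,1],[0,−2,1,0],[0,1,−2,0],[1,0,0,0]] be 4×4 complex matrices. Then: (a) ρ_e is a density matrix and H is Hermitian but not negative semidefinite (its eigenvalues are 1, −1, −1, −3); (b) Tr(Hρ_e) = 1; (c) (x⊗y)†H(x⊗y) ≤ 0 for all x, y ∈ ℂ²; hence (d) for every ε with 0 < ε < 1, the matrix H − εI satisfies Tr((H−εI)ρ_e) = 1 − ε > 0 while (x⊗y)†(H−εI)(x⊗y) ≤ −ε < 0 for all unit vectors x, y ∈ ℂ²; consequently (e) ρ_e is entangled. -/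
open Matrix
open scoped ComplexOrder

noncomputable section

/-- Enumeration of `Fin 2 × Fin 2` in the order `(0,0), (0,1), (1,0), (1,1)`,
matching the standard Kronecker-product ordering of `ℂ⁴ = ℂ²⊗ℂ²`. -/
def kidx : Fin 4 → Fin 2 × Fin 2 := ![(0, 0), (0, 1), (1, 0), (1, 1)]

/-- The Kronecker product `x ⊗ y = (x₁y₁, x₁y₂, x₂y₁, x₂y₂)ᵀ ∈ ℂ⁴`. -/
def vKron (x y : Fin 2 → ℂ) : Fin 4 → ℂ :=
  fun i => x (kidx i).1 * y (kidx i).2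

/-- The Kronecker product of `2 × 2` matrices, as a `4 × 4` matrix in the same
ordering. -/
def mKron (A B : Matrix (Fin 2) (Fin 2) ℂ) : Matrix (Fin 4) (Fin 4) ℂ :=
  Matrix.of fun i j => A (kidx i).1 (kidx j).1 * B (kidx i).2 (kidx j).2

/-- A density matrix: positive semidefinite (hence Hermitian) with trace 1. -/
def IsDensity {d : Type*} [Fintype d] [DecidableEq d] (ρ : Matrix d d ℂ) : Prop :=
  ρ.PosSemidef ∧ ρ.trace = 1

/-- Separability of a density matrix on `ℂ⁴ = ℂ²⊗ℂ²`. -/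
def Separable (ρ : Matrix (Fin 4) (Fin 4) ℂ) : Prop :=
  ∃ (k : ℕ) (p : Fin k → ℝ) (A B : Fin k → Matrix (Fin 2) (Fin 2) ℂ),
    (∀ i, 0 ≤ p i) ∧ (∑ i, p i = 1) ∧ (∀ i, IsDensity (A i)) ∧
      (∀ i, IsDensity (B i)) ∧ ρ = ∑ i, p i • mKron (A i) (B i)

/-- The entangled state `ρ_e = ½ (|00⟩+|11⟩)(⟨00|+⟨11|)`. -/
def rhoE : Matrix (Fin 4) (Fin 4) ℂ :=
  (1 / 2 : ℂ) • !![1, 0, 0, 1; 0, 0, 0, 0; 0, 0, 0, 0; 1, 0, 0, 1]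

/-- The indefinite Hermitian matrix `H`. -/
def Hmat : Matrix (Fin 4) (Fin 4) ℂ :=
  !![0, 0, 0, 1; 0, -2, 1, 0; 0, 1, -2, 0; 1, 0, 0, 0]

/-- The form of `Hmat` on a product vector is minus a sum of two squared moduli. -/
theorem form_Hmat_vKron (x y : Fin 2 → ℂ) :
    star (vKron x y) ⬝ᵥ Hmat *ᵥ vKron x y =
      -(star (x 0 * y 1 - x 1 * y 0) * (x 0 * y 1 - x 1 * y 0) +
        star (x 0 * star (y 1) - x 1 * star (y 0)) *
          (x 0 * star (y 1) - x 1 * star (y 0))) := by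
  simp [vKron, kidx, Hmat, dotProduct, Fin.sum_univ_four, mulVec]
  ring

theorem form_Hmat_vKron_nonpos (x y : Fin 2 → ℂ) :
    star (vKron x y) ⬝ᵥ Hmat *ᵥ vKron x y ≤ 0 := by
  rw [form_Hmat_vKron]
  exact neg_nonpos.2 (add_nonneg (star_mul_self_nonneg _) (star_mul_self_nonneg _))

theorem star_vKron_dotProduct (x y : Fin 2 → ℂ) :
    star (vKron x y) ⬝ᵥ vKron x y = (star x ⬝ᵥ x) * (star y ⬝ᵥ y) := by
  simp [vKron, kidx, dotProduct, Fin.sum_univ_four]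
  ring

theorem trace_mul_mKron_conjTranspose_mul_self
    (G : Matrix (Fin 4) (Fin 4) ℂ) (C D : Matrix (Fin 2) (Fin 2) ℂ) :
    (G * mKron (Cᴴ * C) (Dᴴ * D)).trace =
      ∑ r, ∑ s, star (vKron (star (C r)) (star (D s))) ⬝ᵥ
        G *ᵥ vKron (star (C r)) (star (D s)) := by
  simp [vKron, mKron, kidx, dotProduct, Fin.sum_univ_four, mulVec, trace, mul_apply]
  ring

open scoped MatrixOrder Matrix.Norms.L2Operator in
theorem Matrix.PosSemidef.exists_eq_conjTranspose_mul_self {n : Type*} [Fintype n] [DecidableEq n]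
    {A : Matrix n n ℂ} (hA : A.PosSemidef) : ∃ C : Matrix n n ℂ, A = Cᴴ * C :=
  CStarAlgebra.nonneg_iff_eq_star_mul_self.1 hA.nonneg

theorem trace_Hmat_mul_mKron_nonpos {A B : Matrix (Fin 2) (Fin 2) ℂ}
    (hA : A.PosSemidef) (hB : B.PosSemidef) : (Hmat * mKron A B).trace ≤ 0 := by
  obtain ⟨C, rfl⟩ := hA.exists_eq_conjTranspose_mul_self
  obtain ⟨D, rfl⟩ := hB.exists_eq_conjTranspose_mul_self
  rw [trace_mul_mKron_conjTranspose_mul_self]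
  exact Finset.sum_nonpos fun r _ => Finset.sum_nonpos fun s _ => form_Hmat_vKron_nonpos _ _

theorem trace_Hmat_mul_nonpos_of_separable {ρ : Matrix (Fin 4) (Fin 4) ℂ}
    (h : Separable ρ) : (Hmat * ρ).trace ≤ 0 := by
  obtain ⟨k, p, A, B, hp, -, hA, hB, rfl⟩ := h
  rw [Finset.mul_sum, trace_sum]
  refine Finset.sum_nonpos fun i _ => ?_
  rw [Matrix.mul_smul, trace_smul]
  exact smul_nonpos_of_nonneg_of_nonpos (hp i) (trace_Hmat_mul_mKron_nonpos (hA i).1 (hB i).1)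

theorem isDensity_rhoE : IsDensity rhoE := by
  constructor
  · have h : rhoE = (1 / 2 : ℂ) • vecMulVec ![1, 0, 0, 1] (star ![1, 0, 0, 1]) := by
      ext i j
      fin_cases i <;> fin_cases j <;> simp [rhoE, -cons_vecMulVec, -vecMulVec_cons, vecMulVec_apply]
    rw [h]
    exact (posSemidef_vecMulVec_self_star _).smul (by positivity)
  · simp [rhoE, trace, Fin.sum_univ_four]
    norm_num

theorem isHermitian_Hmat : Hmat.IsHermitian := by
  ext i j
  fin_cases i <;> fin_cases j <;> simp [Hmat]

theorem not_posSemidef_neg_Hmat : ¬(-Hmat).PosSemidef := by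
  intro h
  have h1 := h.dotProduct_mulVec_nonneg ![1, 0, 0, 1]
  simp [Hmat, dotProduct, Fin.sum_univ_four, mulVec] at h1
  norm_num [Complex.le_def] at h1

theorem trace_Hmat_mul_rhoE : (Hmat * rhoE).trace = 1 := by
  simp [Hmat, rhoE, trace, Fin.sum_univ_four]
  norm_num

/-- (a) `ρ_e` is a density matrix and `H` is Hermitian but not
negative semidefinite; (b) `Tr(Hρ_e) = 1`; (c) `(x⊗y)† H (x⊗y) ≤ 0` for all
`x, y ∈ ℂ²`; (d) for `0 < ε < 1`, `Tr((H−εI)ρ_e) = 1−ε > 0` while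
`(x⊗y)†(H−εI)(x⊗y) ≤ −ε < 0` on unit vectors; (e) `ρ_e` is entangled. -/
theorem stmt16 :
    (IsDensity rhoE ∧ Hmat.IsHermitian ∧ ¬(-Hmat).PosSemidef)
    ∧ (Hmat * rhoE).trace = 1
    ∧ (∀ x y : Fin 2 → ℂ, star (vKron x y) ⬝ᵥ Hmat *ᵥ vKron x y ≤ 0)
    ∧ (∀ ε : ℝ, 0 < ε → ε < 1 →
        ((Hmat - (ε : ℂ) • 1) * rhoE).trace = ((1 - ε : ℝ) : ℂ) ∧
        (0 : ℂ) < ((1 - ε : ℝ) : ℂ) ∧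
        ∀ x y : Fin 2 → ℂ, star x ⬝ᵥ x = 1 → star y ⬝ᵥ y = 1 →
          star (vKron x y) ⬝ᵥ (Hmat - (ε : ℂ) • 1) *ᵥ vKron x y ≤ -(ε : ℂ) ∧
            -(ε : ℂ) < 0)
    ∧ ¬Separable rhoE := by
  refine ⟨⟨isDensity_rhoE, isHermitian_Hmat, not_posSemidef_neg_Hmat⟩, trace_Hmat_mul_rhoE,
    form_Hmat_vKron_nonpos, fun ε hε hε1 => ⟨?_, ?_, fun x y hx hy => ⟨?_, ?_⟩⟩, fun h => ?_⟩
  · rw [sub_mul, trace_sub, trace_Hmat_mul_rhoE, Matrix.smul_mul, one_mul, trace_smul,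
      isDensity_rhoE.2]
    simp
  · exact_mod_cast sub_pos.2 hε1
  · rw [sub_mulVec, dotProduct_sub, smul_mulVec, one_mulVec, dotProduct_smul,
      star_vKron_dotProduct, hx, hy]
    simpa using form_Hmat_vKron_nonpos x y
  · exact neg_neg_of_pos (by exact_mod_cast hε)
  · have h1 := trace_Hmat_mul_nonpos_of_separable h
    rw [trace_Hmat_mul_rhoE] at h1
    exact one_pos.not_ge h1
end
end
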